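/- Let A and B be quadratic 𝕜-algebras and let τ: B⊗A → A⊗B be a graded twisting map such that A⊗_τB is a quadratic algebra. Then τ has the unique extension property. -/

import Mathlib

open TensorProduct

noncomputable section

namespace TTP

variable (𝕜 : Type) [Field 𝕜]

/-- The image of `p ⊗ q` inside `M ⊗[𝕜] N`, for submodules `p ⊆ M`, `q ⊆ N`. -/
def subTmul {M N : Type} [AddCommGroup M] [Module 𝕜 M] [AddCommGroup N] [Module 𝕜 N]
    (p : Submodule 𝕜 M) (q : Submodule 𝕜 N) : Submodule 𝕜 (M ⊗[𝕜] N) :=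
  LinearMap.range (TensorProduct.map p.subtype q.subtype)

/-- The Künneth grading on a tensor product of graded vector spaces. -/
def kunneth {M N : Type} [AddCommGroup M] [Module 𝕜 M] [AddCommGroup N] [Module 𝕜 N]
    (𝒜 : ℕ → Submodule 𝕜 M) (ℬ : ℕ → Submodule 𝕜 N) (n : ℕ) : Submodule 𝕜 (M ⊗[𝕜] N) :=
  ⨆ (pq : ℕ × ℕ) (_ : pq.1 + pq.2 = n), subTmul 𝕜 (𝒜 pq.1) (ℬ pq.2)

/-- The positive part `X₊ = ⊕_{i>0} X_i` of a graded vector space. -/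
def plusPart {M : Type} [AddCommGroup M] [Module 𝕜 M] (𝒜 : ℕ → Submodule 𝕜 M) :
    Submodule 𝕜 M :=
  ⨆ (i : ℕ) (_ : 0 < i), 𝒜 i

/-- The grading concentrating `𝒜 1` in degree `1` (and `⊥` elsewhere). -/
def degOne {M : Type} [AddCommGroup M] [Module 𝕜 M] (𝒜 : ℕ → Submodule 𝕜 M) :
    ℕ → Submodule 𝕜 M :=
  fun n => if n = 1 then 𝒜 1 else ⊥

variable (A B : Type) [Ring A] [Algebra 𝕜 A] [Ring B] [Algebra 𝕜 B]

/-- `τ ∘ (μ_B ⊗ μ_A)` on `(B ⊗ B) ⊗ (A ⊗ A)`. -/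
def twistLHS (τ : B ⊗[𝕜] A →ₗ[𝕜] A ⊗[𝕜] B) :
    (B ⊗[𝕜] B) ⊗[𝕜] (A ⊗[𝕜] A) →ₗ[𝕜] A ⊗[𝕜] B :=
  τ ∘ₗ TensorProduct.map (LinearMap.mul' 𝕜 B) (LinearMap.mul' 𝕜 A)

/-- `(μ_A ⊗ μ_B) ∘ (1_A ⊗ τ ⊗ 1_B) ∘ (τ ⊗ τ) ∘ (1_B ⊗ τ ⊗ 1_A)` on `(B ⊗ B) ⊗ (A ⊗ A)`. -/
def twistRHS (τ : B ⊗[𝕜] A →ₗ[𝕜] A ⊗[𝕜] B) :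
    (B ⊗[𝕜] B) ⊗[𝕜] (A ⊗[𝕜] A) →ₗ[𝕜] A ⊗[𝕜] B :=
  TensorProduct.map (LinearMap.mul' 𝕜 A) (LinearMap.mul' 𝕜 B)
    ∘ₗ (TensorProduct.assoc 𝕜 A A (B ⊗[𝕜] B)).symm.toLinearMap
    ∘ₗ LinearMap.lTensor A (TensorProduct.assoc 𝕜 A B B).toLinearMap
    ∘ₗ LinearMap.lTensor A (LinearMap.rTensor B τ)
    ∘ₗ LinearMap.lTensor A (TensorProduct.assoc 𝕜 B A B).symm.toLinearMap
    ∘ₗ (TensorProduct.assoc 𝕜 A B (A ⊗[𝕜] B)).toLinearMap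
    ∘ₗ TensorProduct.map τ τ
    ∘ₗ (TensorProduct.assoc 𝕜 B A (B ⊗[𝕜] A)).symm.toLinearMap
    ∘ₗ LinearMap.lTensor B (TensorProduct.assoc 𝕜 A B A).toLinearMap
    ∘ₗ LinearMap.lTensor B (LinearMap.rTensor A τ)
    ∘ₗ LinearMap.lTensor B (TensorProduct.assoc 𝕜 B A A).symm.toLinearMap
    ∘ₗ (TensorProduct.assoc 𝕜 B B (A ⊗[𝕜] A)).toLinearMap

/-- `τ : B ⊗ A → A ⊗ B` is an (algebra) twisting map: it satisfies the unital twisting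
conditions and `τ(μ_B ⊗ μ_A) = (μ_A ⊗ μ_B)(1_A ⊗ τ ⊗ 1_B)(τ ⊗ τ)(1_B ⊗ τ ⊗ 1_A)`. -/
def IsTwisting (τ : B ⊗[𝕜] A →ₗ[𝕜] A ⊗[𝕜] B) : Prop :=
  (∀ a : A, τ ((1 : B) ⊗ₜ[𝕜] a) = a ⊗ₜ[𝕜] (1 : B)) ∧
  (∀ b : B, τ (b ⊗ₜ[𝕜] (1 : A)) = (1 : A) ⊗ₜ[𝕜] b) ∧
  twistLHS 𝕜 A B τ = twistRHS 𝕜 A B τ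

/-- `τ` preserves the Künneth grading. -/
def IsGradedMapBA (𝒜 : ℕ → Submodule 𝕜 A) (ℬ : ℕ → Submodule 𝕜 B)
    (τ : B ⊗[𝕜] A →ₗ[𝕜] A ⊗[𝕜] B) : Prop :=
  ∀ n, Submodule.map τ (kunneth 𝕜 ℬ 𝒜 n) ≤ kunneth 𝕜 𝒜 ℬ n

/-- `τ` is a graded twisting map. -/
def IsGradedTwisting (𝒜 : ℕ → Submodule 𝕜 A) (ℬ : ℕ → Submodule 𝕜 B)
    (τ : B ⊗[𝕜] A →ₗ[𝕜] A ⊗[𝕜] B) : Prop :=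
  IsTwisting 𝕜 A B τ ∧ IsGradedMapBA 𝕜 A B 𝒜 ℬ τ

/-- A graded linear map `τ` is graded twisting to degree `n`:  it satisfies the unital
conditions and the twisting identity in all (Künneth) degrees `≤ n`. -/
def TwistingToDeg (𝒜 : ℕ → Submodule 𝕜 A) (ℬ : ℕ → Submodule 𝕜 B)
    (τ : B ⊗[𝕜] A →ₗ[𝕜] A ⊗[𝕜] B) (n : ℕ) : Prop :=
  IsGradedMapBA 𝕜 A B 𝒜 ℬ τ ∧
  (∀ j ≤ n, ∀ a ∈ 𝒜 j, τ ((1 : B) ⊗ₜ[𝕜] a) = a ⊗ₜ[𝕜] (1 : B)) ∧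
  (∀ j ≤ n, ∀ b ∈ ℬ j, τ (b ⊗ₜ[𝕜] (1 : A)) = (1 : A) ⊗ₜ[𝕜] b) ∧
  (∀ j ≤ n, ∀ x ∈ kunneth 𝕜 (kunneth 𝕜 ℬ ℬ) (kunneth 𝕜 𝒜 𝒜) j,
    twistLHS 𝕜 A B τ x = twistRHS 𝕜 A B τ x)

/-- The unique extension property of a graded twisting map:  for every `n ≥ 3`, any
linear map `τ'` that is graded twisting to degree `n` and agrees with `τ` in all degrees
`< n` also agrees with `τ` in degree `n`. -/
def UEP (𝒜 : ℕ → Submodule 𝕜 A) (ℬ : ℕ → Submodule 𝕜 B)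
    (τ : B ⊗[𝕜] A →ₗ[𝕜] A ⊗[𝕜] B) : Prop :=
  ∀ n, 3 ≤ n → ∀ τ' : B ⊗[𝕜] A →ₗ[𝕜] A ⊗[𝕜] B,
    TwistingToDeg 𝕜 A B 𝒜 ℬ τ' n →
    (∀ i < n, ∀ x ∈ kunneth 𝕜 ℬ 𝒜 i, τ' x = τ x) →
    ∀ x ∈ kunneth 𝕜 ℬ 𝒜 n, τ' x = τ x

/-- The multiplication `μ_τ = (μ_A ⊗ μ_B)(1_A ⊗ τ ⊗ 1_B)` on `A ⊗ B`. -/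
def mulTau (τ : B ⊗[𝕜] A →ₗ[𝕜] A ⊗[𝕜] B) :
    (A ⊗[𝕜] B) ⊗[𝕜] (A ⊗[𝕜] B) →ₗ[𝕜] A ⊗[𝕜] B :=
  TensorProduct.map (LinearMap.mul' 𝕜 A) (LinearMap.mul' 𝕜 B)
    ∘ₗ (TensorProduct.assoc 𝕜 A A (B ⊗[𝕜] B)).symm.toLinearMap
    ∘ₗ LinearMap.lTensor A (TensorProduct.assoc 𝕜 A B B).toLinearMap
    ∘ₗ LinearMap.lTensor A (LinearMap.rTensor B τ)
    ∘ₗ LinearMap.lTensor A (TensorProduct.assoc 𝕜 B A B).symm.toLinearMap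
    ∘ₗ (TensorProduct.assoc 𝕜 A B (A ⊗[𝕜] B)).toLinearMap

/-- `(C, ψ)` realizes the twisted tensor product algebra `A ⊗_τ B`:  `ψ` is a linear
isomorphism carrying the multiplication `μ_τ` and its unit to those of `C`. -/
def Realizes (τ : B ⊗[𝕜] A →ₗ[𝕜] A ⊗[𝕜] B) (C : Type) [Ring C] [Algebra 𝕜 C]
    (ψ : A ⊗[𝕜] B →ₗ[𝕜] C) : Prop :=
  Function.Bijective ψ ∧ ψ ((1 : A) ⊗ₜ[𝕜] (1 : B)) = 1 ∧
  ∀ x y : A ⊗[𝕜] B, ψ (mulTau 𝕜 A B τ (x ⊗ₜ[𝕜] y)) = ψ x * ψ y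

/-- The two-sided ideal generated by a subset, as a `𝕜`-submodule. -/
def idealSpan (C : Type) [Ring C] [Algebra 𝕜 C] (s : Set C) : Submodule 𝕜 C :=
  Submodule.span 𝕜 {x | ∃ c d r, r ∈ s ∧ x = c * r * d}

/-- Weight grading of the tensor algebra. -/
def tensorWeight (V : Type) [AddCommGroup V] [Module 𝕜 V] (n : ℕ) :
    Submodule 𝕜 (TensorAlgebra 𝕜 V) :=
  LinearMap.range (TensorAlgebra.ι 𝕜 (M := V)) ^ n

instance (V : Type) [AddCommGroup V] [Module 𝕜 V] : GradedAlgebra (tensorWeight 𝕜 V) :=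
  inferInstanceAs (GradedAlgebra
    ((LinearMap.range (TensorAlgebra.ι 𝕜 : V →ₗ[𝕜] TensorAlgebra 𝕜 V) ^ ·) : ℕ → Submodule 𝕜 _))

/-- The canonical map `T(C₁) → C` for a graded algebra `C`. -/
def canMap (C : Type) [Ring C] [Algebra 𝕜 C] (𝒞 : ℕ → Submodule 𝕜 C) :
    TensorAlgebra 𝕜 ↥(𝒞 1) →ₐ[𝕜] C :=
  TensorAlgebra.lift 𝕜 (𝒞 1).subtype

/-- `C` (with grading `𝒞`) is a quadratic algebra: the canonical map `T(C₁) → C` is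
surjective and its kernel is generated, as a two-sided ideal, by its degree 2 part. -/
def IsQuadraticAlg (C : Type) [Ring C] [Algebra 𝕜 C] (𝒞 : ℕ → Submodule 𝕜 C) : Prop :=
  Function.Surjective (canMap 𝕜 C 𝒞) ∧
  LinearMap.ker (canMap 𝕜 C 𝒞).toLinearMap =
    idealSpan 𝕜 (TensorAlgebra 𝕜 ↥(𝒞 1))
      ((LinearMap.ker (canMap 𝕜 C 𝒞).toLinearMap ⊓ tensorWeight 𝕜 ↥(𝒞 1) 2 : Submodule 𝕜 _) : Set _)

/-- The left ideal generated by the positive part of a graded algebra. -/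
def augIdeal (C : Type) [Ring C] [Algebra 𝕜 C] (𝒞 : ℕ → Submodule 𝕜 C) : Submodule C C :=
  Submodule.span C {x : C | ∃ i, 0 < i ∧ x ∈ 𝒞 i}

/-- The degree `n` component of the graded free module on generators `σ` in degree `i`. -/
def freeGrade (C : Type) [Ring C] [Algebra 𝕜 C] (𝒞 : ℕ → Submodule 𝕜 C)
    (i : ℕ) (σ : Type) (n : ℕ) : Submodule 𝕜 (σ →₀ C) :=
  ⨅ (j : σ), Submodule.comap (Finsupp.lapply j : (σ →₀ C) →ₗ[𝕜] C)
    (if i ≤ n then 𝒞 (n - i) else ⊥)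

/-- `C` (with grading `𝒞`) is a Koszul algebra: the trivial module `𝕜 = C/C₊` admits a
resolution by graded free modules with the `i`-th term generated in degree `i`. -/
def IsKoszul (C : Type) [Ring C] [Algebra 𝕜 C] (𝒞 : ℕ → Submodule 𝕜 C) : Prop :=
  ∃ (σ : ℕ → Type) (d : ∀ i : ℕ, ((σ (i + 1)) →₀ C) →ₗ[C] ((σ i) →₀ C))
    (ε : ((σ 0) →₀ C) →ₗ[C] (C ⧸ augIdeal 𝕜 C 𝒞)),
    Function.Surjective ε ∧
    LinearMap.ker ε = LinearMap.range (d 0) ∧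
    (∀ i, LinearMap.ker (d i) = LinearMap.range (d (i + 1))) ∧
    (∀ i n, ∀ x ∈ freeGrade 𝕜 C 𝒞 (i + 1) (σ (i + 1)) n, d i x ∈ freeGrade 𝕜 C 𝒞 i (σ i) n) ∧
    (∀ n, 0 < n → ∀ x ∈ freeGrade 𝕜 C 𝒞 0 (σ 0) n, ε x = 0)

/-- `(P, ιA, ιB)` is a free product (coproduct) of `A` and `B`. -/
def IsFreeProduct (P : Type) [Ring P] [Algebra 𝕜 P] (ιA : A →ₐ[𝕜] P) (ιB : B →ₐ[𝕜] P) :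
    Prop :=
  ∀ (C : Type) [Ring C] [Algebra 𝕜 C], ∀ (f : A →ₐ[𝕜] C) (g : B →ₐ[𝕜] C),
    ∃! h : P →ₐ[𝕜] C, h.comp ιA = f ∧ h.comp ιB = g

/-- The linear map `A ⊗ B → P`, `a ⊗ b ↦ ιA(a) · ιB(b)`. -/
def mulMapP (P : Type) [Ring P] [Algebra 𝕜 P] (ιA : A →ₐ[𝕜] P) (ιB : B →ₐ[𝕜] P) :
    A ⊗[𝕜] B →ₗ[𝕜] P :=
  TensorProduct.lift (LinearMap.mk₂ 𝕜 (fun a b => ιA a * ιB b)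
    (fun a a' b => by simp [map_add, add_mul])
    (fun c a b => by simp [map_smul, smul_mul_assoc])
    (fun a b b' => by simp [map_add, mul_add])
    (fun c a b => by simp [map_smul, mul_smul_comm]))

/-- The set of `τ`-relations `b ⊗ a - τ(b ⊗ a)` of total degree at most `n`,
inside the free product `P`. -/
def relSetLe (P : Type) [Ring P] [Algebra 𝕜 P] (ιA : A →ₐ[𝕜] P) (ιB : B →ₐ[𝕜] P)
    (𝒜 : ℕ → Submodule 𝕜 A) (ℬ : ℕ → Submodule 𝕜 B)
    (τ : B ⊗[𝕜] A →ₗ[𝕜] A ⊗[𝕜] B) (n : ℕ) : Set P :=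
  {x | ∃ i j a b, i + j ≤ n ∧ a ∈ 𝒜 i ∧ b ∈ ℬ j ∧
    x = ιB b * ιA a - mulMapP 𝕜 A B P ιA ιB (τ (b ⊗ₜ[𝕜] a))}

/-- The set of all `τ`-relations `b ⊗ a - τ(b ⊗ a)` inside the free product `P`. -/
def relSetAll (P : Type) [Ring P] [Algebra 𝕜 P] (ιA : A →ₐ[𝕜] P) (ιB : B →ₐ[𝕜] P)
    (τ : B ⊗[𝕜] A →ₗ[𝕜] A ⊗[𝕜] B) : Set P :=
  {x | ∃ a b, x = ιB b * ιA a - mulMapP 𝕜 A B P ιA ιB (τ (b ⊗ₜ[𝕜] a))}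

/-- The (Künneth) grading on the free product `P` of the graded algebras `A` and `B`. -/
def freeProdGrade (P : Type) [Ring P] [Algebra 𝕜 P] (ιA : A →ₐ[𝕜] P) (ιB : B →ₐ[𝕜] P)
    (𝒜 : ℕ → Submodule 𝕜 A) (ℬ : ℕ → Submodule 𝕜 B) (n : ℕ) : Submodule 𝕜 P :=
  ⨆ (l : List ℕ) (_ : l.sum = n),
    ((l.map (fun i => Submodule.map ιA.toLinearMap (𝒜 i) ⊔ Submodule.map ιB.toLinearMap (ℬ i))).foldr
      (· * ·) 1)

end TTP

namespace TTP

section Kunneth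

variable {𝕜 : Type} [Field 𝕜] {M N : Type} [AddCommGroup M] [Module 𝕜 M]
  [AddCommGroup N] [Module 𝕜 N]

theorem tmul_mem_kunneth {𝒜 : ℕ → Submodule 𝕜 M} {ℬ : ℕ → Submodule 𝕜 N} {i j n : ℕ}
    (h : i + j = n) {a : M} {b : N} (ha : a ∈ 𝒜 i) (hb : b ∈ ℬ j) :
    a ⊗ₜ[𝕜] b ∈ kunneth 𝕜 𝒜 ℬ n := by
  refine Submodule.mem_iSup_of_mem (i, j) (Submodule.mem_iSup_of_mem h ?_)
  exact ⟨(⟨a, ha⟩ : 𝒜 i) ⊗ₜ (⟨b, hb⟩ : ℬ j), by simp⟩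

theorem kunneth_le {𝒜 : ℕ → Submodule 𝕜 M} {ℬ : ℕ → Submodule 𝕜 N} {n : ℕ}
    {S : Submodule 𝕜 (M ⊗[𝕜] N)}
    (h : ∀ i j, i + j = n → ∀ a ∈ 𝒜 i, ∀ b ∈ ℬ j, a ⊗ₜ[𝕜] b ∈ S) :
    kunneth 𝕜 𝒜 ℬ n ≤ S := by
  refine iSup₂_le fun pq hpq => ?_
  rintro _ ⟨x, rfl⟩
  induction x with
  | zero => simp
  | tmul a b => exact h _ _ hpq _ a.2 _ b.2
  | add x y hx hy => rw [map_add]; exact S.add_mem hx hy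

/-- Two linear maps agreeing on homogeneous pure tensors of degree `n` agree in degree `n`. -/
theorem eq_of_mem_kunneth {𝒜 : ℕ → Submodule 𝕜 M} {ℬ : ℕ → Submodule 𝕜 N} {n : ℕ}
    {P : Type} [AddCommGroup P] [Module 𝕜 P] {f g : M ⊗[𝕜] N →ₗ[𝕜] P}
    (h : ∀ i j, i + j = n → ∀ a ∈ 𝒜 i, ∀ b ∈ ℬ j, f (a ⊗ₜ b) = g (a ⊗ₜ b))
    {x : M ⊗[𝕜] N} (hx : x ∈ kunneth 𝕜 𝒜 ℬ n) : f x = g x :=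
  (kunneth_le (S := LinearMap.eqLocus f g) h) hx

/-- The part of a linear map concentrated in Künneth degree `n`. -/
theorem exists_concentrated (𝒜 : ℕ → Submodule 𝕜 M) (ℬ : ℕ → Submodule 𝕜 N)
    [DirectSum.Decomposition 𝒜] [DirectSum.Decomposition ℬ]
    {P : Type} [AddCommGroup P] [Module 𝕜 P] (f : M ⊗[𝕜] N →ₗ[𝕜] P) (n : ℕ) :
    ∃ δ : M ⊗[𝕜] N →ₗ[𝕜] P, ∀ i j, ∀ a ∈ 𝒜 i, ∀ b ∈ ℬ j,
      δ (a ⊗ₜ b) = if i + j = n then f (a ⊗ₜ b) else 0 := by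
  let pA (i : ℕ) : M →ₗ[𝕜] M := (𝒜 i).subtype ∘ₗ DirectSum.component 𝕜 ℕ _ i ∘ₗ
    (DirectSum.decomposeLinearEquiv 𝒜).toLinearMap
  let pB (i : ℕ) : N →ₗ[𝕜] N := (ℬ i).subtype ∘ₗ DirectSum.component 𝕜 ℕ _ i ∘ₗ
    (DirectSum.decomposeLinearEquiv ℬ).toLinearMap
  have hA : ∀ i j, ∀ a ∈ 𝒜 i, pA j a = if i = j then a else 0 := by
    intro i j a ha
    change ((DirectSum.decompose 𝒜 a j : 𝒜 j) : M) = _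
    split_ifs with h
    · subst h; exact DirectSum.decompose_of_mem_same 𝒜 ha
    · exact DirectSum.decompose_of_mem_ne 𝒜 ha h
  have hB : ∀ i j, ∀ a ∈ ℬ i, pB j a = if i = j then a else 0 := by
    intro i j a ha
    change ((DirectSum.decompose ℬ a j : ℬ j) : N) = _
    split_ifs with h
    · subst h; exact DirectSum.decompose_of_mem_same ℬ ha
    · exact DirectSum.decompose_of_mem_ne ℬ ha h
  refine ⟨∑ p ∈ Finset.HasAntidiagonal.antidiagonal n,
    f ∘ₗ TensorProduct.map (pA p.1) (pB p.2), ?_⟩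
  intro i j a ha b hb
  simp only [LinearMap.sum_apply, LinearMap.comp_apply, TensorProduct.map_tmul]
  have key : ∀ p ∈ Finset.HasAntidiagonal.antidiagonal n, f (pA p.1 a ⊗ₜ[𝕜] pB p.2 b) =
      if (i, j) = p then f (a ⊗ₜ b) else 0 := by
    rintro ⟨p, q⟩ -
    rw [hA i p a ha, hB j q b hb]
    by_cases h1 : i = p <;> by_cases h2 : j = q <;> simp [h1, h2]
  rw [Finset.sum_congr rfl key, Finset.sum_ite_eq]
  simp

end Kunneth

section Counit

variable {𝕜 : Type} [Field 𝕜] {B : Type} [Ring B] [Algebra 𝕜 B]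

/-- A connected graded algebra is augmented. -/
theorem exists_counit [Nontrivial B] (ℬ : ℕ → Submodule 𝕜 B) [GradedAlgebra ℬ]
    (hconn : ℬ 0 = 1) :
    ∃ ε : B →ₐ[𝕜] 𝕜, (∀ i, 0 < i → ∀ b ∈ ℬ i, ε b = 0) ∧
      ∀ b ∈ ℬ 0, b = algebraMap 𝕜 B (ε b) := by
  have hinj : Function.Injective (algebraMap 𝕜 B) := (algebraMap 𝕜 B).injective
  have h0 (b : B) : ∃ c : 𝕜, algebraMap 𝕜 B c = GradedRing.projZeroRingHom ℬ b := by
    have : GradedRing.projZeroRingHom ℬ b ∈ ℬ 0 := SetLike.coe_mem _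
    rwa [hconn, Submodule.mem_one] at this
  choose e he using h0
  have hscal (r : 𝕜) : e (algebraMap 𝕜 B r) = r := by
    apply hinj
    rw [he]
    refine DirectSum.decompose_of_mem_same ℬ ?_
    rw [hconn, Submodule.mem_one]
    exact ⟨r, rfl⟩
  let ε : B →ₐ[𝕜] 𝕜 :=
    { toFun := e
      map_one' := by simpa using hscal 1
      map_zero' := by simpa using hscal 0
      map_mul' := fun x y => hinj (by rw [he, map_mul, map_mul, he, he])
      map_add' := fun x y => hinj (by simp [he])
      commutes' := hscal }
  refine ⟨ε, fun i hi b hb => hinj ?_, fun b hb => ?_⟩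
  · rw [map_zero]
    exact (he b).trans (DirectSum.decompose_of_mem_ne ℬ hb hi.ne')
  · exact ((he b).trans (DirectSum.decompose_of_mem_same ℬ hb)).symm

end Counit

section Twist

variable {𝕜 : Type} [Field 𝕜] {A B : Type} [Ring A] [Algebra 𝕜 A] [Ring B] [Algebra 𝕜 B]

/-- Left multiplication by `a` and right multiplication by `b` on `A ⊗ B`. -/
def biMul (a : A) (b : B) : A ⊗[𝕜] B →ₗ[𝕜] A ⊗[𝕜] B :=
  TensorProduct.map (LinearMap.mulLeft 𝕜 a) (LinearMap.mulRight 𝕜 b)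

@[simp]
theorem biMul_tmul (a a' : A) (b b' : B) :
    biMul (𝕜 := 𝕜) a b (a' ⊗ₜ b') = (a * a') ⊗ₜ (b' * b) := by
  simp [biMul]

@[simp]
theorem biMul_one_one (x : A ⊗[𝕜] B) : biMul 1 1 x = x := by
  simp [biMul]

theorem biMul_biMul (a a' : A) (b b' : B) (x : A ⊗[𝕜] B) :
    biMul a b (biMul a' b' x) = biMul (a * a') (b' * b) x := by
  induction x with
  | zero => simp
  | tmul x y => simp [mul_assoc]
  | add x y hx hy => simp [hx, hy]

theorem biMul_one_algebraMap (r : 𝕜) (x : A ⊗[𝕜] B) : biMul 1 (algebraMap 𝕜 B r) x = r • x := by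
  induction x with
  | zero => simp
  | tmul x y => simp [← Algebra.commutes, ← Algebra.smul_def]
  | add x y hx hy => simp [hx, hy]

theorem biMul_algebraMap_one (r : 𝕜) (x : A ⊗[𝕜] B) : biMul (algebraMap 𝕜 A r) 1 x = r • x := by
  induction x with
  | zero => simp
  | tmul x y => simp [← Algebra.smul_def, TensorProduct.smul_tmul']
  | add x y hx hy => simp [hx, hy]

theorem mulTau_tmul (σ : B ⊗[𝕜] A →ₗ[𝕜] A ⊗[𝕜] B) (a a' : A) (b b' : B) :
    mulTau 𝕜 A B σ ((a ⊗ₜ b) ⊗ₜ (a' ⊗ₜ b')) = biMul a b' (σ (b ⊗ₜ a')) := by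
  simp only [mulTau, LinearMap.comp_apply, LinearEquiv.coe_coe, TensorProduct.assoc_tmul,
    LinearMap.lTensor_tmul, TensorProduct.assoc_symm_tmul, LinearMap.rTensor_tmul]
  induction σ (b ⊗ₜ[𝕜] a') with
  | zero => simp
  | tmul x y => simp
  | add x y hx hy => simp only [TensorProduct.add_tmul, TensorProduct.tmul_add, map_add, hx, hy]

/-- The operator `a ⊗ b ↦ σ(b₁ ⊗ a) · σ(b ⊗ a₂)` appearing in the twisting identity. -/
def twistOp (σ : B ⊗[𝕜] A →ₗ[𝕜] A ⊗[𝕜] B) (b₁ : B) (a₂ : A) :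
    A ⊗[𝕜] B →ₗ[𝕜] A ⊗[𝕜] B :=
  mulTau 𝕜 A B σ ∘ₗ TensorProduct.map (σ ∘ₗ TensorProduct.mk 𝕜 B A b₁)
    (σ ∘ₗ (TensorProduct.mk 𝕜 B A).flip a₂)

@[simp]
theorem twistOp_tmul (σ : B ⊗[𝕜] A →ₗ[𝕜] A ⊗[𝕜] B) (b₁ b : B) (a₂ a : A) :
    twistOp σ b₁ a₂ (a ⊗ₜ b) = mulTau 𝕜 A B σ (σ (b₁ ⊗ₜ a) ⊗ₜ σ (b ⊗ₜ a₂)) := by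
  simp [twistOp]

theorem twistRHS_tmul (σ : B ⊗[𝕜] A →ₗ[𝕜] A ⊗[𝕜] B) (b₁ b₂ : B) (a₁ a₂ : A) :
    twistRHS 𝕜 A B σ ((b₁ ⊗ₜ b₂) ⊗ₜ (a₁ ⊗ₜ a₂)) = twistOp σ b₁ a₂ (σ (b₂ ⊗ₜ a₁)) := by
  change mulTau 𝕜 A B σ _ = _
  simp only [LinearMap.comp_apply, LinearEquiv.coe_coe, TensorProduct.assoc_tmul,
    LinearMap.lTensor_tmul, TensorProduct.assoc_symm_tmul, LinearMap.rTensor_tmul]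
  induction σ (b₂ ⊗ₜ[𝕜] a₁) with
  | zero => simp
  | tmul x y => simp
  | add x y hx hy => simp only [TensorProduct.add_tmul, TensorProduct.tmul_add, map_add, hx, hy]

theorem twistLHS_tmul (σ : B ⊗[𝕜] A →ₗ[𝕜] A ⊗[𝕜] B) (b₁ b₂ : B) (a₁ a₂ : A) :
    twistLHS 𝕜 A B σ ((b₁ ⊗ₜ b₂) ⊗ₜ (a₁ ⊗ₜ a₂)) = σ ((b₁ * b₂) ⊗ₜ (a₁ * a₂)) := by
  simp [twistLHS]

variable {τ : B ⊗[𝕜] A →ₗ[𝕜] A ⊗[𝕜] B}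

theorem IsTwisting.mulTau_one_tmul_right (hτ : IsTwisting 𝕜 A B τ) (x : A ⊗[𝕜] B) (b : B) :
    mulTau 𝕜 A B τ (x ⊗ₜ (1 ⊗ₜ b)) = biMul 1 b x := by
  induction x with
  | zero => simp
  | tmul a' b' => simp [mulTau_tmul, hτ.2.1]
  | add x y hx hy => simp only [TensorProduct.add_tmul, map_add, hx, hy]

theorem IsTwisting.mulTau_tmul_one_left (hτ : IsTwisting 𝕜 A B τ) (x : A ⊗[𝕜] B) (a : A) :
    mulTau 𝕜 A B τ ((a ⊗ₜ 1) ⊗ₜ x) = biMul a 1 x := by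
  induction x with
  | zero => simp
  | tmul a' b' => simp [mulTau_tmul, hτ.1]
  | add x y hx hy => simp only [TensorProduct.tmul_add, map_add, hx, hy]

theorem mulTau_biMul_left (x y : A ⊗[𝕜] B) (a : A) :
    mulTau 𝕜 A B τ (biMul a 1 x ⊗ₜ y) = biMul a 1 (mulTau 𝕜 A B τ (x ⊗ₜ y)) := by
  induction x with
  | zero => simp
  | add x x' hx hy => simp only [TensorProduct.add_tmul, map_add, hx, hy]
  | tmul a' b' =>
    induction y with
    | zero => simp
    | add x y hx hy => simp only [TensorProduct.tmul_add, map_add, hx, hy]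
    | tmul a'' b'' => simp [mulTau_tmul, biMul_biMul]

theorem mulTau_biMul_right (x y : A ⊗[𝕜] B) (b : B) :
    mulTau 𝕜 A B τ (x ⊗ₜ biMul 1 b y) = biMul 1 b (mulTau 𝕜 A B τ (x ⊗ₜ y)) := by
  induction y with
  | zero => simp
  | add x x' hx hy => simp only [TensorProduct.tmul_add, map_add, hx, hy]
  | tmul a' b' =>
    induction x with
    | zero => simp
    | add x y hx hy => simp only [TensorProduct.add_tmul, map_add, hx, hy]
    | tmul a'' b'' => simp [mulTau_tmul, biMul_biMul]

theorem IsTwisting.apply_mul_left (hτ : IsTwisting 𝕜 A B τ) (b₁ b₂ : B) (a : A) :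
    τ ((b₁ * b₂) ⊗ₜ a) = mulTau 𝕜 A B τ ((1 ⊗ₜ b₁) ⊗ₜ τ (b₂ ⊗ₜ a)) := by
  have h := LinearMap.congr_fun hτ.2.2 ((b₁ ⊗ₜ b₂) ⊗ₜ (a ⊗ₜ 1))
  rw [twistLHS_tmul, twistRHS_tmul, mul_one] at h
  rw [h]
  induction τ (b₂ ⊗ₜ[𝕜] a) with
  | zero => simp
  | add x y hx hy => simp only [TensorProduct.tmul_add, map_add, hx, hy]
  | tmul x y => simp [hτ.2.1, hτ.mulTau_one_tmul_right, mulTau_tmul]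

theorem IsTwisting.apply_mul_right (hτ : IsTwisting 𝕜 A B τ) (b : B) (a₁ a₂ : A) :
    τ (b ⊗ₜ (a₁ * a₂)) = mulTau 𝕜 A B τ (τ (b ⊗ₜ a₁) ⊗ₜ (a₂ ⊗ₜ 1)) := by
  have h := LinearMap.congr_fun hτ.2.2 ((1 ⊗ₜ b) ⊗ₜ (a₁ ⊗ₜ a₂))
  rw [twistLHS_tmul, twistRHS_tmul, one_mul] at h
  rw [h]
  induction τ (b ⊗ₜ[𝕜] a₁) with
  | zero => simp
  | add x y hx hy => simp only [TensorProduct.add_tmul, map_add, hx, hy]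
  | tmul x y => simp [hτ.1, hτ.mulTau_tmul_one_left, mulTau_tmul]

theorem IsTwisting.mulTau_biMul_middle_left (hτ : IsTwisting 𝕜 A B τ) (x : A ⊗[𝕜] B) (b : B)
    (a : A) : mulTau 𝕜 A B τ (biMul 1 b x ⊗ₜ (a ⊗ₜ 1)) =
      mulTau 𝕜 A B τ (x ⊗ₜ τ (b ⊗ₜ a)) := by
  induction x with
  | zero => simp
  | add x y hx hy => simp only [TensorProduct.add_tmul, map_add, hx, hy]
  | tmul x y =>
    rw [biMul_tmul, mulTau_tmul, one_mul, hτ.apply_mul_left, ← mulTau_biMul_left, biMul_tmul,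
      mul_one, mul_one]

theorem IsTwisting.mulTau_biMul_middle_right (hτ : IsTwisting 𝕜 A B τ) (x : A ⊗[𝕜] B) (b : B)
    (a : A) : mulTau 𝕜 A B τ ((1 ⊗ₜ b) ⊗ₜ biMul a 1 x) =
      mulTau 𝕜 A B τ (τ (b ⊗ₜ a) ⊗ₜ x) := by
  induction x with
  | zero => simp
  | add x y hx hy => simp only [TensorProduct.tmul_add, map_add, hx, hy]
  | tmul x y =>
    rw [biMul_tmul, mulTau_tmul, mul_one, hτ.apply_mul_right, ← mulTau_biMul_right, biMul_tmul,
      one_mul, one_mul]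

theorem IsTwisting.mulTau_assoc (hτ : IsTwisting 𝕜 A B τ) (x y z : A ⊗[𝕜] B) :
    mulTau 𝕜 A B τ (mulTau 𝕜 A B τ (x ⊗ₜ y) ⊗ₜ z) =
      mulTau 𝕜 A B τ (x ⊗ₜ mulTau 𝕜 A B τ (y ⊗ₜ z)) := by
  induction x with
  | zero => simp
  | add x x' hx hy => simp only [TensorProduct.add_tmul, map_add, hx, hy]
  | tmul a b =>
  induction y with
  | zero => simp
  | add x x' hx hy => simp only [TensorProduct.add_tmul, TensorProduct.tmul_add, map_add, hx, hy]
  | tmul a' b' =>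
  induction z with
  | zero => simp
  | add x x' hx hy => simp only [TensorProduct.tmul_add, map_add, hx, hy]
  | tmul a'' b'' =>
  have h1 : a ⊗ₜ[𝕜] b = biMul a 1 (1 ⊗ₜ b) := by simp
  have h2 : a'' ⊗ₜ[𝕜] b'' = biMul 1 b'' (a'' ⊗ₜ 1) := by simp
  have h3 (x : A ⊗[𝕜] B) : biMul a b' x = biMul a 1 (biMul 1 b' x) := by simp [biMul_biMul]
  have h4 (x : A ⊗[𝕜] B) : biMul a' b'' x = biMul 1 b'' (biMul a' 1 x) := by simp [biMul_biMul]
  rw [mulTau_tmul, mulTau_tmul, h3, h4, h1, h2]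
  simp only [mulTau_biMul_left, mulTau_biMul_right, hτ.mulTau_biMul_middle_left,
    hτ.mulTau_biMul_middle_right]

/-- The twisted tensor product algebra `A ⊗_τ B`. -/
def TwistedTensor (_ : IsTwisting 𝕜 A B τ) : Type := A ⊗[𝕜] B

namespace TwistedTensor

variable (hτ : IsTwisting 𝕜 A B τ)

instance : AddCommGroup (TwistedTensor hτ) := inferInstanceAs (AddCommGroup (A ⊗[𝕜] B))

instance : Module 𝕜 (TwistedTensor hτ) := inferInstanceAs (Module 𝕜 (A ⊗[𝕜] B))

/-- The identity map from `A ⊗ B` to `A ⊗_τ B`. -/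
def of : A ⊗[𝕜] B ≃ₗ[𝕜] TwistedTensor hτ := LinearEquiv.refl 𝕜 (A ⊗[𝕜] B)

instance : Mul (TwistedTensor hτ) :=
  ⟨fun x y => of hτ (mulTau 𝕜 A B τ ((of hτ).symm x ⊗ₜ (of hτ).symm y))⟩

instance : One (TwistedTensor hτ) := ⟨of hτ (1 ⊗ₜ 1)⟩

theorem of_mul_of (x y : A ⊗[𝕜] B) :
    of hτ x * of hτ y = of hτ (mulTau 𝕜 A B τ (x ⊗ₜ y)) := rfl

theorem one_def : (1 : TwistedTensor hτ) = of hτ (1 ⊗ₜ 1) := rfl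

instance : Ring (TwistedTensor hτ) :=
  { (inferInstance : AddCommGroup (TwistedTensor hτ)),
    (inferInstance : Mul (TwistedTensor hτ)),
    (inferInstance : One (TwistedTensor hτ)) with
    left_distrib := (of hτ).surjective.forall₃.2 fun x y z => by
      simp only [← map_add, of_mul_of, TensorProduct.tmul_add]
    right_distrib := (of hτ).surjective.forall₃.2 fun x y z => by
      simp only [← map_add, of_mul_of, TensorProduct.add_tmul]
    zero_mul := (of hτ).surjective.forall.2 fun x => by
      rw [← map_zero (of hτ), of_mul_of]; simp
    mul_zero := (of hτ).surjective.forall.2 fun x => by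
      rw [← map_zero (of hτ), of_mul_of]; simp
    mul_assoc := (of hτ).surjective.forall₃.2 fun x y z => by
      simp only [of_mul_of, hτ.mulTau_assoc]
    one_mul := (of hτ).surjective.forall.2 fun x => by
      rw [one_def, of_mul_of, hτ.mulTau_tmul_one_left, biMul_one_one]
    mul_one := (of hτ).surjective.forall.2 fun x => by
      rw [one_def, of_mul_of, hτ.mulTau_one_tmul_right, biMul_one_one] }

instance : Algebra 𝕜 (TwistedTensor hτ) :=
  Algebra.ofModule
    (fun r => (of hτ).surjective.forall₂.2 fun x y => by
      simp only [← map_smul, of_mul_of, TensorProduct.smul_tmul'])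
    (fun r => (of hτ).surjective.forall₂.2 fun x y => by
      simp only [← map_smul, of_mul_of, TensorProduct.tmul_smul])

theorem realizes : Realizes 𝕜 A B τ (TwistedTensor hτ) (of hτ).toLinearMap :=
  ⟨(of hτ).bijective, rfl, fun x y => (of_mul_of hτ x y).symm⟩

end TwistedTensor

end Twist

section Cocycle

variable {𝕜 : Type} [Field 𝕜] {A B : Type} [Ring A] [Algebra 𝕜 A] [Ring B] [Algebra 𝕜 B]
  {𝒜 : ℕ → Submodule 𝕜 A} {ℬ : ℕ → Submodule 𝕜 B}
  {τ τ' δ : B ⊗[𝕜] A →ₗ[𝕜] A ⊗[𝕜] B} {n : ℕ} {εA : A →ₐ[𝕜] 𝕜} {εB : B →ₐ[𝕜] 𝕜}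

/-- The projection `A ⊗ B → A` induced by an augmentation of `B`. -/
def counitRight (A : Type) [Ring A] [Algebra 𝕜 A] (ε : B →ₐ[𝕜] 𝕜) : A ⊗[𝕜] B →ₗ[𝕜] A :=
  (TensorProduct.rid 𝕜 A).toLinearMap ∘ₗ LinearMap.lTensor A ε.toLinearMap

@[simp]
theorem counitRight_tmul (ε : B →ₐ[𝕜] 𝕜) (a : A) (b : B) :
    counitRight A ε (a ⊗ₜ b) = ε b • a := by
  simp [counitRight]

/-- The projection `A ⊗ B → B` induced by an augmentation of `A`. -/
def counitLeft (B : Type) [Ring B] [Algebra 𝕜 B] (ε : A →ₐ[𝕜] 𝕜) : A ⊗[𝕜] B →ₗ[𝕜] B :=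
  (TensorProduct.lid 𝕜 B).toLinearMap ∘ₗ LinearMap.rTensor B ε.toLinearMap

@[simp]
theorem counitLeft_tmul (ε : A →ₐ[𝕜] 𝕜) (a : A) (b : B) :
    counitLeft B ε (a ⊗ₜ b) = ε a • b := by
  simp [counitLeft]

theorem counitRight_mem (h : ∀ i, 0 < i → ∀ b ∈ ℬ i, εB b = 0) {m : ℕ} {x : A ⊗[𝕜] B}
    (hx : x ∈ kunneth 𝕜 𝒜 ℬ m) : counitRight A εB x ∈ 𝒜 m := by
  refine (kunneth_le (S := (𝒜 m).comap (counitRight A εB)) fun i j hij a ha b hb => ?_) hx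
  rw [Submodule.mem_comap, counitRight_tmul]
  rcases Nat.eq_zero_or_pos j with rfl | hj
  · obtain rfl : i = m := hij
    exact Submodule.smul_mem _ _ ha
  · simp [h j hj b hb]

theorem counitLeft_mem (h : ∀ i, 0 < i → ∀ a ∈ 𝒜 i, εA a = 0) {m : ℕ} {x : A ⊗[𝕜] B}
    (hx : x ∈ kunneth 𝕜 𝒜 ℬ m) : counitLeft B εA x ∈ ℬ m := by
  refine (kunneth_le (S := (ℬ m).comap (counitLeft B εA)) fun i j hij a ha b hb => ?_) hx
  rw [Submodule.mem_comap, counitLeft_tmul]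
  rcases Nat.eq_zero_or_pos i with rfl | hi
  · obtain rfl : j = m := by omega
    exact Submodule.smul_mem _ _ hb
  · simp [h i hi a ha]

theorem IsGradedMapBA.apply_mem (h : IsGradedMapBA 𝕜 A B 𝒜 ℬ τ) {m : ℕ} {x : B ⊗[𝕜] A}
    (hx : x ∈ kunneth 𝕜 ℬ 𝒜 m) : τ x ∈ kunneth 𝕜 𝒜 ℬ m :=
  h m (Submodule.mem_map_of_mem hx)

theorem TwistingToDeg.mulTau_one_tmul_right (h : TwistingToDeg 𝕜 A B 𝒜 ℬ τ n) {m : ℕ}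
    (hm : m ≤ n) {x : A ⊗[𝕜] B} (hx : x ∈ kunneth 𝕜 𝒜 ℬ m) (b : B) :
    mulTau 𝕜 A B τ (x ⊗ₜ (1 ⊗ₜ b)) = biMul 1 b x := by
  refine eq_of_mem_kunneth
    (f := mulTau 𝕜 A B τ ∘ₗ (TensorProduct.mk 𝕜 _ _).flip (1 ⊗ₜ b)) (g := biMul 1 b) ?_ hx
  intro i j hij a ha b' hb'
  simp [mulTau_tmul, h.2.2.1 j (by omega) b' hb']

theorem TwistingToDeg.mulTau_tmul_one_left (h : TwistingToDeg 𝕜 A B 𝒜 ℬ τ n) {m : ℕ}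
    (hm : m ≤ n) {x : A ⊗[𝕜] B} (hx : x ∈ kunneth 𝕜 𝒜 ℬ m) (a : A) :
    mulTau 𝕜 A B τ ((a ⊗ₜ 1) ⊗ₜ x) = biMul a 1 x := by
  refine eq_of_mem_kunneth
    (f := mulTau 𝕜 A B τ ∘ₗ TensorProduct.mk 𝕜 _ _ (a ⊗ₜ 1)) (g := biMul a 1) ?_ hx
  intro i j hij a' ha' b hb
  simp [mulTau_tmul, h.2.1 i (by omega) a' ha']

theorem TwistingToDeg.twistOp_one_right (h : TwistingToDeg 𝕜 A B 𝒜 ℬ τ n) {i p q : ℕ}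
    (hn : i + p + q ≤ n) {b₁ b : B} {a : A} (hb₁ : b₁ ∈ ℬ i) (ha : a ∈ 𝒜 p) (hb : b ∈ ℬ q) :
    twistOp τ b₁ 1 (a ⊗ₜ b) = biMul 1 b (τ (b₁ ⊗ₜ a)) := by
  rw [twistOp_tmul, h.2.2.1 q (by omega) b hb]
  exact h.mulTau_one_tmul_right (m := i + p) (by omega)
    (h.1.apply_mem (tmul_mem_kunneth rfl hb₁ ha)) b

theorem TwistingToDeg.twistOp_one_left (h : TwistingToDeg 𝕜 A B 𝒜 ℬ τ n) {i p q : ℕ}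
    (hn : i + p + q ≤ n) {b : B} {a₂ a : A} (ha₂ : a₂ ∈ 𝒜 i) (ha : a ∈ 𝒜 p) (hb : b ∈ ℬ q) :
    twistOp τ 1 a₂ (a ⊗ₜ b) = biMul a 1 (τ (b ⊗ₜ a₂)) := by
  rw [twistOp_tmul, h.2.1 p (by omega) a ha]
  exact h.mulTau_tmul_one_left (m := q + i) (by omega)
    (h.1.apply_mem (tmul_mem_kunneth rfl hb ha₂)) a

theorem IsGradedTwisting.twistingToDeg (h : IsGradedTwisting 𝕜 A B 𝒜 ℬ τ) (n : ℕ) :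
    TwistingToDeg 𝕜 A B 𝒜 ℬ τ n :=
  ⟨h.2, fun _ _ a _ => h.1.1 a, fun _ _ b _ => h.1.2.1 b,
    fun _ _ x _ => LinearMap.congr_fun h.1.2.2 x⟩

theorem TwistingToDeg.apply_mul_left [SetLike.GradedMonoid 𝒜]
    (h : TwistingToDeg 𝕜 A B 𝒜 ℬ τ n) {i₁ i₂ j : ℕ}
    (hn : i₁ + i₂ + j ≤ n) {b₁ b₂ : B} {a : A} (hb₁ : b₁ ∈ ℬ i₁) (hb₂ : b₂ ∈ ℬ i₂)
    (ha : a ∈ 𝒜 j) : τ ((b₁ * b₂) ⊗ₜ a) = twistOp τ b₁ 1 (τ (b₂ ⊗ₜ a)) := by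
  have := h.2.2.2 (i₁ + i₂ + j) hn ((b₁ ⊗ₜ b₂) ⊗ₜ (a ⊗ₜ 1))
    (tmul_mem_kunneth rfl (tmul_mem_kunneth rfl hb₁ hb₂)
      (tmul_mem_kunneth (add_zero j) ha SetLike.GradedOne.one_mem))
  rwa [twistLHS_tmul, twistRHS_tmul, mul_one] at this

theorem TwistingToDeg.apply_mul_right [SetLike.GradedMonoid ℬ]
    (h : TwistingToDeg 𝕜 A B 𝒜 ℬ τ n) {i j₁ j₂ : ℕ}
    (hn : i + j₁ + j₂ ≤ n) {b : B} {a₁ a₂ : A} (hb : b ∈ ℬ i) (ha₁ : a₁ ∈ 𝒜 j₁)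
    (ha₂ : a₂ ∈ 𝒜 j₂) : τ (b ⊗ₜ (a₁ * a₂)) = twistOp τ 1 a₂ (τ (b ⊗ₜ a₁)) := by
  have := h.2.2.2 (i + (j₁ + j₂)) (by omega) ((1 ⊗ₜ b) ⊗ₜ (a₁ ⊗ₜ a₂))
    (tmul_mem_kunneth rfl (tmul_mem_kunneth (zero_add i) SetLike.GradedOne.one_mem hb)
      (tmul_mem_kunneth rfl ha₁ ha₂))
  rwa [twistLHS_tmul, twistRHS_tmul, one_mul] at this

/-- `δ` is the degree `n` part of `f`. -/
def IsConcentrated (𝒜 : ℕ → Submodule 𝕜 A) (ℬ : ℕ → Submodule 𝕜 B) (n : ℕ)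
    (f δ : B ⊗[𝕜] A →ₗ[𝕜] A ⊗[𝕜] B) : Prop :=
  ∀ i j, ∀ b ∈ ℬ i, ∀ a ∈ 𝒜 j, δ (b ⊗ₜ a) = if i + j = n then f (b ⊗ₜ a) else 0

theorem IsConcentrated.one_tmul [GradedAlgebra 𝒜] [SetLike.GradedMonoid ℬ]
    (hδ : IsConcentrated 𝒜 ℬ n (τ' - τ) δ) (hτ : TwistingToDeg 𝕜 A B 𝒜 ℬ τ n)
    (hτ' : TwistingToDeg 𝕜 A B 𝒜 ℬ τ' n) (a : A) : δ (1 ⊗ₜ a) = 0 := by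
  induction a using DirectSum.Decomposition.inductionOn 𝒜 with
  | zero => simp
  | add x y hx hy => simp [TensorProduct.tmul_add, hx, hy]
  | @homogeneous j a =>
    rw [hδ 0 j 1 SetLike.GradedOne.one_mem a a.2]
    split_ifs with h
    · rw [LinearMap.sub_apply, hτ.2.1 j (by omega) a a.2, hτ'.2.1 j (by omega) a a.2, sub_self]
    · rfl

theorem IsConcentrated.tmul_one [GradedAlgebra ℬ] [SetLike.GradedMonoid 𝒜]
    (hδ : IsConcentrated 𝒜 ℬ n (τ' - τ) δ) (hτ : TwistingToDeg 𝕜 A B 𝒜 ℬ τ n)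
    (hτ' : TwistingToDeg 𝕜 A B 𝒜 ℬ τ' n) (b : B) : δ (b ⊗ₜ 1) = 0 := by
  induction b using DirectSum.Decomposition.inductionOn ℬ with
  | zero => simp
  | add x y hx hy => simp [TensorProduct.add_tmul, hx, hy]
  | @homogeneous j b =>
    rw [hδ j 0 b b.2 1 SetLike.GradedOne.one_mem]
    split_ifs with h
    · rw [LinearMap.sub_apply, hτ.2.2.1 j (by omega) b b.2, hτ'.2.2.1 j (by omega) b b.2, sub_self]
    · rfl

/-- If `τ` and `τ'` are twisting to degree `n` and agree below degree `n`, their difference in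
degree `n` satisfies a cocycle identity with respect to the multiplication of `B`. -/
theorem IsConcentrated.mul_tmul [GradedAlgebra 𝒜] [GradedAlgebra ℬ]
    (hδ : IsConcentrated 𝒜 ℬ n (τ' - τ) δ) (hτ : TwistingToDeg 𝕜 A B 𝒜 ℬ τ n)
    (hτ' : TwistingToDeg 𝕜 A B 𝒜 ℬ τ' n)
    (hlt : ∀ i < n, ∀ x ∈ kunneth 𝕜 ℬ 𝒜 i, τ' x = τ x)
    (hpos : ∀ i, 0 < i → ∀ b ∈ ℬ i, εB b = 0)
    (hzero : ∀ b ∈ ℬ 0, b = algebraMap 𝕜 B (εB b)) (b₁ b₂ : B) (a : A) :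
    δ ((b₁ * b₂) ⊗ₜ a) =
      εB b₁ • δ (b₂ ⊗ₜ a) + δ (b₁ ⊗ₜ counitRight A εB (τ (b₂ ⊗ₜ a))) := by
  induction b₁ using DirectSum.Decomposition.inductionOn ℬ with
  | zero => simp
  | add x y hx hy =>
    simp only [add_mul, TensorProduct.add_tmul, map_add, hx, hy, add_smul]; abel
  | @homogeneous i₁ b₁ =>
  induction b₂ using DirectSum.Decomposition.inductionOn ℬ with
  | zero => simp
  | add x y hx hy =>
    simp only [mul_add, TensorProduct.add_tmul, TensorProduct.tmul_add, map_add, hx, hy,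
      smul_add]
    abel
  | @homogeneous i₂ b₂ =>
  induction a using DirectSum.Decomposition.inductionOn 𝒜 with
  | zero => simp
  | add x y hx hy =>
    simp only [TensorProduct.tmul_add, map_add, hx, hy, smul_add]; abel
  | @homogeneous j a =>
  have hx := hτ.1.apply_mem (tmul_mem_kunneth (n := i₂ + j) rfl b₂.2 a.2)
  rcases Nat.eq_zero_or_pos i₁ with rfl | hi₁
  · rw [hzero b₁ b₁.2]
    simp [Algebra.algebraMap_eq_smul_one, ← TensorProduct.smul_tmul', hδ.one_tmul hτ hτ']
  rw [hpos i₁ hi₁ b₁ b₁.2, zero_smul, zero_add,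
    hδ (i₁ + i₂) j _ (SetLike.GradedMul.mul_mem b₁.2 b₂.2) a a.2]
  split_ifs with hn
  · rw [LinearMap.sub_apply, hτ'.apply_mul_left hn.le b₁.2 b₂.2 a.2,
      hτ.apply_mul_left hn.le b₁.2 b₂.2 a.2,
      hlt (i₂ + j) (by omega) _ (tmul_mem_kunneth rfl b₂.2 a.2)]
    refine eq_of_mem_kunneth (f := twistOp τ' b₁ 1 - twistOp τ b₁ 1)
      (g := δ ∘ₗ TensorProduct.mk 𝕜 B A b₁ ∘ₗ counitRight A εB) ?_ hx
    intro p q hpq a' ha' b' hb'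
    rw [LinearMap.sub_apply, hτ'.twistOp_one_right (by omega) b₁.2 ha' hb',
      hτ.twistOp_one_right (by omega) b₁.2 ha' hb', ← map_sub, ← LinearMap.sub_apply]
    simp only [LinearMap.comp_apply, counitRight_tmul, TensorProduct.mk_apply, map_smul]
    rcases Nat.eq_zero_or_pos q with rfl | hq
    · rw [hδ i₁ p b₁ b₁.2 a' ha', if_pos (by omega), hzero b' hb']
      simp [biMul_one_algebraMap]
    · rw [hpos q hq b' hb', zero_smul, LinearMap.sub_apply,
        hlt (i₁ + p) (by omega) _ (tmul_mem_kunneth rfl b₁.2 ha'), sub_self, map_zero]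
  · rw [hδ i₁ (i₂ + j) b₁ b₁.2 _ (counitRight_mem hpos hx), if_neg (by omega)]

/-- If `τ` and `τ'` are twisting to degree `n` and agree below degree `n`, their difference in
degree `n` satisfies a cocycle identity with respect to the multiplication of `A`. -/
theorem IsConcentrated.tmul_mul [GradedAlgebra 𝒜] [GradedAlgebra ℬ]
    (hδ : IsConcentrated 𝒜 ℬ n (τ' - τ) δ) (hτ : TwistingToDeg 𝕜 A B 𝒜 ℬ τ n)
    (hτ' : TwistingToDeg 𝕜 A B 𝒜 ℬ τ' n)
    (hlt : ∀ i < n, ∀ x ∈ kunneth 𝕜 ℬ 𝒜 i, τ' x = τ x)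
    (hpos : ∀ i, 0 < i → ∀ a ∈ 𝒜 i, εA a = 0)
    (hzero : ∀ a ∈ 𝒜 0, a = algebraMap 𝕜 A (εA a)) (b : B) (a₁ a₂ : A) :
    δ (b ⊗ₜ (a₁ * a₂)) =
      εA a₂ • δ (b ⊗ₜ a₁) + δ (counitLeft B εA (τ (b ⊗ₜ a₁)) ⊗ₜ a₂) := by
  induction a₂ using DirectSum.Decomposition.inductionOn 𝒜 with
  | zero => simp
  | add x y hx hy =>
    simp only [mul_add, TensorProduct.tmul_add, map_add, hx, hy, add_smul]; abel
  | @homogeneous j₂ a₂ =>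
  induction a₁ using DirectSum.Decomposition.inductionOn 𝒜 with
  | zero => simp
  | add x y hx hy =>
    simp only [add_mul, TensorProduct.add_tmul, TensorProduct.tmul_add, map_add, hx, hy,
      smul_add]
    abel
  | @homogeneous j₁ a₁ =>
  induction b using DirectSum.Decomposition.inductionOn ℬ with
  | zero => simp
  | add x y hx hy =>
    simp only [TensorProduct.add_tmul, map_add, hx, hy, smul_add]; abel
  | @homogeneous i b =>
  have hx := hτ.1.apply_mem (tmul_mem_kunneth (n := i + j₁) rfl b.2 a₁.2)
  rcases Nat.eq_zero_or_pos j₂ with rfl | hj₂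
  · rw [hzero a₂ a₂.2]
    simp [Algebra.algebraMap_eq_smul_one, TensorProduct.tmul_smul, hδ.tmul_one hτ hτ']
  rw [hpos j₂ hj₂ a₂ a₂.2, zero_smul, zero_add,
    hδ i (j₁ + j₂) b b.2 _ (SetLike.GradedMul.mul_mem a₁.2 a₂.2)]
  split_ifs with hn
  · rw [LinearMap.sub_apply, hτ'.apply_mul_right (by omega) b.2 a₁.2 a₂.2,
      hτ.apply_mul_right (by omega) b.2 a₁.2 a₂.2,
      hlt (i + j₁) (by omega) _ (tmul_mem_kunneth rfl b.2 a₁.2)]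
    refine eq_of_mem_kunneth (f := twistOp τ' 1 a₂ - twistOp τ 1 a₂)
      (g := δ ∘ₗ (TensorProduct.mk 𝕜 B A).flip a₂ ∘ₗ counitLeft B εA) ?_ hx
    intro p q hpq a' ha' b' hb'
    rw [LinearMap.sub_apply, hτ'.twistOp_one_left (by omega) a₂.2 ha' hb',
      hτ.twistOp_one_left (by omega) a₂.2 ha' hb', ← map_sub, ← LinearMap.sub_apply]
    simp only [LinearMap.comp_apply, counitLeft_tmul, LinearMap.flip_apply,
      TensorProduct.mk_apply, map_smul]
    rcases Nat.eq_zero_or_pos p with rfl | hp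
    · rw [hδ q j₂ b' hb' a₂ a₂.2, if_pos (by omega), hzero a' ha']
      simp [biMul_algebraMap_one]
    · rw [hpos p hp a' ha', zero_smul, LinearMap.sub_apply,
        hlt (q + j₂) (by omega) _ (tmul_mem_kunneth rfl hb' a₂.2), sub_self, map_zero]
  · rw [hδ (i + j₁) j₂ _ (counitLeft_mem hpos hx) a₂ a₂.2, if_neg (by omega)]

end Cocycle

section Quadratic

variable {𝕜 : Type} [Field 𝕜] {C R : Type} [Ring C] [Algebra 𝕜 C] [Ring R] [Algebra 𝕜 R]
  {𝒞 : ℕ → Submodule 𝕜 C}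

@[simp]
theorem canMap_ι (x : 𝒞 1) : canMap 𝕜 C 𝒞 (TensorAlgebra.ι 𝕜 x) = x := by
  simp [canMap]

theorem algHom_ext_of_surjective_canMap (h : Function.Surjective (canMap 𝕜 C 𝒞))
    {f g : C →ₐ[𝕜] R} (hfg : ∀ c ∈ 𝒞 1, f c = g c) : f = g := by
  have : f.comp (canMap 𝕜 C 𝒞) = g.comp (canMap 𝕜 C 𝒞) := by
    ext x
    simpa using hfg x x.2
  ext c
  obtain ⟨t, rfl⟩ := h c
  exact DFunLike.congr_fun this t

/-- A linear map multiplicative on products of two elements of degree one extends from degree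
one to an algebra homomorphism on a quadratic algebra. -/
theorem IsQuadraticAlg.exists_algHom (h : IsQuadraticAlg 𝕜 C 𝒞) (f : C →ₗ[𝕜] R)
    (hf : ∀ c ∈ 𝒞 1, ∀ d ∈ 𝒞 1, f (c * d) = f c * f d) :
    ∃ g : C →ₐ[𝕜] R, ∀ c ∈ 𝒞 1, g c = f c := by
  let p := canMap 𝕜 C 𝒞
  let φ : TensorAlgebra 𝕜 (𝒞 1) →ₐ[𝕜] R := TensorAlgebra.lift 𝕜 (f ∘ₗ (𝒞 1).subtype)
  have hφ (x : 𝒞 1) : φ (TensorAlgebra.ι 𝕜 x) = f x := by simp [φ]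
  have h2 : ∀ t ∈ tensorWeight 𝕜 (𝒞 1) 2, φ t = f (p t) := by
    have : tensorWeight 𝕜 (𝒞 1) 2 ≤ LinearMap.eqLocus φ.toLinearMap (f ∘ₗ p.toLinearMap) := by
      rw [tensorWeight, pow_two, Submodule.mul_le]
      rintro _ ⟨x, rfl⟩ _ ⟨y, rfl⟩
      simp only [LinearMap.mem_eqLocus, LinearMap.comp_apply, AlgHom.toLinearMap_apply, map_mul,
        hφ, p, canMap_ι]
      exact (hf x x.2 y y.2).symm
    exact fun t ht => this ht
  have hker : ∀ t, p t = 0 → φ t = 0 := by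
    intro t ht
    have ht' : t ∈ LinearMap.ker p.toLinearMap := ht
    rw [h.2] at ht'
    refine (Submodule.span_le (p := LinearMap.ker φ.toLinearMap)).2 ?_ ht'
    rintro _ ⟨c, d, r, ⟨hr0, hr2⟩, rfl⟩
    have hr : φ r = 0 := by
      rw [h2 r hr2, show p r = 0 from hr0, map_zero]
    simp [hr]
  let g := (Ideal.Quotient.liftₐ (RingHom.ker p) φ hker).comp
    (Ideal.quotientKerAlgEquivOfSurjective h.1).symm.toAlgHom
  refine ⟨g, fun c hc => ?_⟩
  have : (Ideal.quotientKerAlgEquivOfSurjective h.1).symm c =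
      Ideal.Quotient.mk _ (TensorAlgebra.ι 𝕜 ⟨c, hc⟩) := by
    rw [AlgEquiv.symm_apply_eq]
    exact (canMap_ι ⟨c, hc⟩).symm
  simp only [g, AlgHom.comp_apply]
  exact (congrArg _ this).trans (hφ ⟨c, hc⟩)

end Quadratic

namespace TwistedTensor

variable {𝕜 : Type} [Field 𝕜] {A B : Type} [Ring A] [Algebra 𝕜 A] [Ring B] [Algebra 𝕜 B]
  {τ : B ⊗[𝕜] A →ₗ[𝕜] A ⊗[𝕜] B} (hτ : IsTwisting 𝕜 A B τ)

/-- The inclusion `a ↦ a ⊗ 1` of `A` into `A ⊗_τ B`. -/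
def inclLeft : A →ₐ[𝕜] TwistedTensor hτ :=
  AlgHom.ofLinearMap ((of hτ).toLinearMap ∘ₗ (TensorProduct.mk 𝕜 A B).flip 1) rfl fun a a' =>
    show of hτ ((a * a') ⊗ₜ 1) = of hτ (a ⊗ₜ 1) * of hτ (a' ⊗ₜ 1) by
      rw [of_mul_of, hτ.mulTau_tmul_one_left, biMul_tmul, one_mul]

/-- The inclusion `b ↦ 1 ⊗ b` of `B` into `A ⊗_τ B`. -/
def inclRight : B →ₐ[𝕜] TwistedTensor hτ :=
  AlgHom.ofLinearMap ((of hτ).toLinearMap ∘ₗ TensorProduct.mk 𝕜 A B 1) rfl fun b b' =>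
    show of hτ (1 ⊗ₜ (b * b')) = of hτ (1 ⊗ₜ b) * of hτ (1 ⊗ₜ b') by
      simp [of_mul_of, mulTau_tmul, hτ.2.1]

theorem inclLeft_apply (a : A) : inclLeft hτ a = of hτ (a ⊗ₜ 1) := rfl

theorem inclRight_apply (b : B) : inclRight hτ b = of hτ (1 ⊗ₜ b) := rfl

theorem inclLeft_mul_of (a : A) (x : A ⊗[𝕜] B) :
    inclLeft hτ a * of hτ x = of hτ (biMul a 1 x) := by
  rw [inclLeft_apply, of_mul_of, hτ.mulTau_tmul_one_left]

theorem inclRight_mul_inclLeft (a : A) (b : B) :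
    inclRight hτ b * inclLeft hτ a = of hτ (τ (b ⊗ₜ a)) := by
  rw [inclLeft_apply, inclRight_apply, of_mul_of, mulTau_tmul, biMul_one_one]

theorem inclLeft_mul_inclRight (a : A) (b : B) :
    inclLeft hτ a * inclRight hτ b = of hτ (a ⊗ₜ b) := by
  rw [inclRight_apply, inclLeft_mul_of]; simp

theorem counitLeft_biMul (εA : A →ₐ[𝕜] 𝕜) (a : A) (x : A ⊗[𝕜] B) :
    counitLeft B εA (biMul a 1 x) = εA a • counitLeft B εA x := by
  induction x with
  | zero => simp
  | tmul x y => simp [mul_smul]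
  | add x y hx hy => simp [hx, hy]

theorem counitRight_biMul (εB : B →ₐ[𝕜] 𝕜) (b : B) (x : A ⊗[𝕜] B) :
    counitRight A εB (biMul 1 b x) = εB b • counitRight A εB x := by
  induction x with
  | zero => simp
  | tmul x y => simp [mul_smul, smul_comm (εB b)]
  | add x y hx hy => simp [hx, hy]

theorem counitRight_mulTau (εB : B →ₐ[𝕜] 𝕜) (b : B) (x : A ⊗[𝕜] B) :
    counitRight A εB (mulTau 𝕜 A B τ ((1 ⊗ₜ b) ⊗ₜ x)) =
      counitRight A εB (τ (b ⊗ₜ counitRight A εB x)) := by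
  induction x with
  | zero => simp
  | tmul x y => simp [mulTau_tmul, counitRight_biMul]
  | add x y hx hy => simp [TensorProduct.tmul_add, hx, hy]

variable (δ : B ⊗[𝕜] A →ₗ[𝕜] A ⊗[𝕜] B) (εA : A →ₐ[𝕜] 𝕜) (εB : B →ₐ[𝕜] 𝕜)

/-- The infinitesimal deformation by `δ` of the left regular representation of `A ⊗_τ B`. -/
def deform : TwistedTensor hτ →ₗ[𝕜] Module.End 𝕜 (TwistedTensor hτ × (A ⊗[𝕜] B)) :=
  LinearMap.mk₂ 𝕜 (fun c v => (c * v.1, εB (counitLeft B εA ((of hτ).symm c)) • v.2 +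
      δ (counitLeft B εA ((of hτ).symm c) ⊗ₜ counitRight A εB ((of hτ).symm v.1))))
    (fun c c' v => by
      ext
      · simp [add_mul]
      · simp only [map_add, add_smul, TensorProduct.add_tmul, Prod.snd_add]; abel)
    (fun r c v => by
      ext
      · simp
      · simp [← TensorProduct.smul_tmul', mul_smul])
    (fun c v v' => by
      ext
      · simp [mul_add]
      · simp only [map_add, smul_add, TensorProduct.tmul_add, Prod.snd_add, Prod.fst_add]; abel)
    (fun r c v => by
      ext
      · simp
      · simp [smul_comm r])

theorem deform_of (z x y : A ⊗[𝕜] B) :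
    deform hτ δ εA εB (of hτ z) (of hτ x, y) =
      (of hτ z * of hτ x, εB (counitLeft B εA z) • y +
        δ (counitLeft B εA z ⊗ₜ counitRight A εB x)) := rfl

theorem deform_inclRight (b : B) (x y : A ⊗[𝕜] B) :
    deform hτ δ εA εB (inclRight hτ b) (of hτ x, y) =
      (inclRight hτ b * of hτ x, εB b • y + δ (b ⊗ₜ counitRight A εB x)) := by
  rw [inclRight_apply, deform_of]; simp

variable {δ}

theorem deform_inclLeft (hδ : ∀ a, δ (1 ⊗ₜ a) = 0) (a : A) (x y : A ⊗[𝕜] B) :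
    deform hτ δ εA εB (inclLeft hτ a) (of hτ x, y) = (inclLeft hτ a * of hτ x, εA a • y) := by
  rw [inclLeft_apply, deform_of]
  simp [← TensorProduct.smul_tmul', hδ]

theorem end_ext {f g : Module.End 𝕜 (TwistedTensor hτ × (A ⊗[𝕜] B))}
    (h : ∀ x y, f (of hτ x, y) = g (of hτ x, y)) : f = g :=
  LinearMap.ext fun v => h ((of hτ).symm v.1) v.2

theorem deform_one (hδ : ∀ a, δ (1 ⊗ₜ a) = 0) : deform hτ δ εA εB 1 = 1 := by
  refine end_ext hτ fun x y => ?_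
  rw [← map_one (inclLeft hτ), deform_inclLeft hτ εA εB hδ]
  simp

theorem deform_inclLeft_mul (hδ : ∀ a, δ (1 ⊗ₜ a) = 0) (a : A) (c : TwistedTensor hτ) :
    deform hτ δ εA εB (inclLeft hτ a * c) =
      deform hτ δ εA εB (inclLeft hτ a) * deform hτ δ εA εB c := by
  obtain ⟨z, rfl⟩ := (of hτ).surjective c
  refine end_ext hτ fun x y => ?_
  rw [Module.End.mul_apply, deform_of, of_mul_of, deform_inclLeft hτ εA εB hδ, inclLeft_mul_of,
    deform_of, inclLeft_mul_of, of_mul_of, mulTau_biMul_left, counitLeft_biMul]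
  simp [← TensorProduct.smul_tmul', mul_smul]

theorem deform_inclRight_mul (hmul : ∀ b₁ b₂ a, δ ((b₁ * b₂) ⊗ₜ a) =
      εB b₁ • δ (b₂ ⊗ₜ a) + δ (b₁ ⊗ₜ counitRight A εB (τ (b₂ ⊗ₜ a)))) (b₁ b₂ : B) :
    deform hτ δ εA εB (inclRight hτ b₁ * inclRight hτ b₂) =
      deform hτ δ εA εB (inclRight hτ b₁) * deform hτ δ εA εB (inclRight hτ b₂) := by
  refine end_ext hτ fun x y => ?_
  rw [Module.End.mul_apply, ← map_mul, deform_inclRight, deform_inclRight, inclRight_apply _ b₂,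
    of_mul_of, deform_inclRight, ← of_mul_of, ← inclRight_apply, map_mul, mul_assoc, hmul,
    counitRight_mulTau]
  simp [mul_smul, add_assoc]

theorem deform_inclRight_mul_inclLeft (hδ : ∀ a, δ (1 ⊗ₜ a) = 0) {a : A} {b : B}
    (hmul : ∀ a', δ (b ⊗ₜ (a * a')) = δ (counitLeft B εA (τ (b ⊗ₜ a)) ⊗ₜ a'))
    (ha : εA a = 0) (hε : εB (counitLeft B εA (τ (b ⊗ₜ a))) = 0) :
    deform hτ δ εA εB (inclRight hτ b * inclLeft hτ a) =
      deform hτ δ εA εB (inclRight hτ b) * deform hτ δ εA εB (inclLeft hτ a) := by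
  refine end_ext hτ fun x y => ?_
  have hx : counitRight A εB (biMul a 1 x) = a * counitRight A εB x := by
    induction x with
    | zero => simp
    | tmul x y => simp
    | add x y hx hy => simp [hx, hy, mul_add]
  rw [Module.End.mul_apply, deform_inclLeft hτ εA εB hδ, inclLeft_mul_of, deform_inclRight, hx,
    hmul, ha, inclRight_mul_inclLeft, deform_of, hε, ← inclRight_mul_inclLeft, ← inclLeft_mul_of,
    mul_assoc]
  simp

end TwistedTensor

open TwistedTensor in
/-- A solution of the cocycle identities concentrated in degree at least three vanishes when the
twisted tensor product is quadratic. -/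
theorem eq_zero_of_cocycle {𝕜 : Type} [Field 𝕜] {A B : Type} [Ring A] [Algebra 𝕜 A] [Ring B]
    [Algebra 𝕜 B] {𝒜 : ℕ → Submodule 𝕜 A} {ℬ : ℕ → Submodule 𝕜 B}
    {τ : B ⊗[𝕜] A →ₗ[𝕜] A ⊗[𝕜] B} {δ : B ⊗[𝕜] A →ₗ[𝕜] A ⊗[𝕜] B}
    {εA : A →ₐ[𝕜] 𝕜} {εB : B →ₐ[𝕜] 𝕜}
    (hA : Function.Surjective (canMap 𝕜 A 𝒜)) (hB : Function.Surjective (canMap 𝕜 B ℬ))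
    (hA0 : 𝒜 0 = 1) (hB0 : ℬ 0 = 1)
    (hεA : ∀ i, 0 < i → ∀ a ∈ 𝒜 i, εA a = 0) (hεB : ∀ i, 0 < i → ∀ b ∈ ℬ i, εB b = 0)
    (hτ : IsGradedTwisting 𝕜 A B 𝒜 ℬ τ)
    (hC : IsQuadraticAlg 𝕜 (TwistedTensor hτ.1)
      fun n => Submodule.map (of hτ.1).toLinearMap (kunneth 𝕜 𝒜 ℬ n))
    (hδ₁ : ∀ a, δ (1 ⊗ₜ a) = 0) (hδ₂ : ∀ b, δ (b ⊗ₜ 1) = 0)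
    (hδ₃ : ∀ b ∈ ℬ 1, ∀ a ∈ 𝒜 1, δ (b ⊗ₜ a) = 0)
    (hmulB : ∀ b₁ b₂ a, δ ((b₁ * b₂) ⊗ₜ a) =
      εB b₁ • δ (b₂ ⊗ₜ a) + δ (b₁ ⊗ₜ counitRight A εB (τ (b₂ ⊗ₜ a))))
    (hmulA : ∀ b a₁ a₂, δ (b ⊗ₜ (a₁ * a₂)) =
      εA a₂ • δ (b ⊗ₜ a₁) + δ (counitLeft B εA (τ (b ⊗ₜ a₁)) ⊗ₜ a₂)) : δ = 0 := by
  set Λ := deform hτ.1 δ εA εB with hΛ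
  have hmem : ∀ c ∈ Submodule.map (of hτ.1).toLinearMap (kunneth 𝕜 𝒜 ℬ 1),
      ∃ a ∈ 𝒜 1, ∃ b ∈ ℬ 1, inclLeft hτ.1 a + inclRight hτ.1 b = c := by
    have : Submodule.map (of hτ.1).toLinearMap (kunneth 𝕜 𝒜 ℬ 1) ≤
        (𝒜 1).map (inclLeft hτ.1).toLinearMap ⊔ (ℬ 1).map (inclRight hτ.1).toLinearMap := by
      rw [Submodule.map_le_iff_le_comap]
      refine kunneth_le fun i j hij a ha b hb => ?_
      rw [Submodule.mem_comap]
      change of hτ.1 (a ⊗ₜ b) ∈ _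
      rw [← inclLeft_mul_inclRight]
      obtain ⟨rfl, rfl⟩ | ⟨rfl, rfl⟩ : i = 0 ∧ j = 1 ∨ i = 1 ∧ j = 0 := by omega
      · rw [hA0, Submodule.mem_one] at ha
        obtain ⟨r, rfl⟩ := ha
        rw [AlgHom.commutes, ← Algebra.smul_def]
        exact Submodule.smul_mem _ _ (Submodule.mem_sup_right (Submodule.mem_map_of_mem hb))
      · rw [hB0, Submodule.mem_one] at hb
        obtain ⟨r, rfl⟩ := hb
        rw [AlgHom.commutes, ← Algebra.commutes, ← Algebra.smul_def]
        exact Submodule.smul_mem _ _ (Submodule.mem_sup_left (Submodule.mem_map_of_mem ha))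
    intro c hc
    obtain ⟨_, ⟨a, ha, rfl⟩, _, ⟨b, hb, rfl⟩, h⟩ := Submodule.mem_sup.1 (this hc)
    exact ⟨a, ha, b, hb, h⟩
  obtain ⟨g, hg⟩ := hC.exists_algHom Λ <| by
    intro c hc d hd
    obtain ⟨a, ha, b, hb, rfl⟩ := hmem c hc
    obtain ⟨a', ha', b', hb', rfl⟩ := hmem d hd
    rw [add_mul, map_add, hΛ, deform_inclLeft_mul hτ.1 εA εB hδ₁, mul_add, map_add, map_add,
      deform_inclRight_mul hτ.1 εA εB hmulB,
      deform_inclRight_mul_inclLeft hτ.1 εA εB hδ₁ ?_ (hεA 1 one_pos a' ha') ?_]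
    · simp only [map_add, mul_add, add_mul]
      abel
    · intro x
      rw [hmulA, hδ₃ b hb a' ha', smul_zero, zero_add]
    · have hba : b ⊗ₜ[𝕜] a' ∈ kunneth 𝕜 ℬ 𝒜 2 := tmul_mem_kunneth one_add_one_eq_two hb ha'
      have h1 : τ (b ⊗ₜ[𝕜] a') ∈ kunneth 𝕜 𝒜 ℬ 2 := hτ.2.apply_mem hba
      have h2 : counitLeft B εA (τ (b ⊗ₜ[𝕜] a')) ∈ ℬ 2 := counitLeft_mem hεA h1
      exact hεB 2 two_pos _ h2
  have hgA (a : A) : g (inclLeft hτ.1 a) = Λ (inclLeft hτ.1 a) := by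
    let ΛA : A →ₐ[𝕜] Module.End 𝕜 (TwistedTensor hτ.1 × (A ⊗[𝕜] B)) :=
      AlgHom.ofLinearMap (Λ ∘ₗ (inclLeft hτ.1).toLinearMap)
        (by simpa using deform_one hτ.1 εA εB hδ₁)
        (fun a a' => by simpa using deform_inclLeft_mul hτ.1 εA εB hδ₁ a _)
    refine DFunLike.congr_fun (f := g.comp (inclLeft hτ.1)) (g := ΛA)
      (algHom_ext_of_surjective_canMap hA fun a ha => hg _ ?_) a
    exact Submodule.mem_map_of_mem (tmul_mem_kunneth (add_zero 1) ha
      (hB0 ▸ Submodule.one_le.1 le_rfl))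
  have hgB (b : B) : g (inclRight hτ.1 b) = Λ (inclRight hτ.1 b) := by
    let ΛB : B →ₐ[𝕜] Module.End 𝕜 (TwistedTensor hτ.1 × (A ⊗[𝕜] B)) :=
      AlgHom.ofLinearMap (Λ ∘ₗ (inclRight hτ.1).toLinearMap)
        (by simpa using deform_one hτ.1 εA εB hδ₁)
        (fun b b' => by simpa using deform_inclRight_mul hτ.1 εA εB hmulB b b')
    refine DFunLike.congr_fun (f := g.comp (inclRight hτ.1)) (g := ΛB)
      (algHom_ext_of_surjective_canMap hB fun b hb => hg _ ?_) b
    exact Submodule.mem_map_of_mem (tmul_mem_kunneth (zero_add 1)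
      (hA0 ▸ Submodule.one_le.1 le_rfl) hb)
  let s : A ⊗[𝕜] B →ₗ[𝕜] A ⊗[𝕜] B :=
    LinearMap.snd 𝕜 _ _ ∘ₗ LinearMap.applyₗ (of hτ.1 (1 ⊗ₜ 1), (0 : A ⊗[𝕜] B)) ∘ₗ
      g.toLinearMap ∘ₗ (of hτ.1).toLinearMap
  have hs (z : A ⊗[𝕜] B) : s z = (g (of hτ.1 z) (of hτ.1 (1 ⊗ₜ 1), 0)).2 := rfl
  have hs0 : s = 0 := by
    refine TensorProduct.ext' fun a b => ?_
    rw [hs, ← inclLeft_mul_inclRight, map_mul, hgA, hgB, Module.End.mul_apply, hΛ,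
      deform_inclRight, inclRight_apply, of_mul_of, deform_inclLeft hτ.1 εA εB hδ₁]
    simp [hδ₂]
  refine TensorProduct.ext' fun b a => ?_
  have h := hs (τ (b ⊗ₜ a))
  rw [hs0, ← inclRight_mul_inclLeft, map_mul, hgA, hgB, Module.End.mul_apply, hΛ,
    deform_inclLeft hτ.1 εA εB hδ₁, inclLeft_mul_of, deform_inclRight] at h
  simpa using h.symm

/-- Proposition 4.6.  Let `A` and `B` be quadratic algebras and `τ : B ⊗ A → A ⊗ B` a
graded twisting map such that the twisted tensor product `A ⊗_τ B` is a quadratic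
algebra.  Then `τ` has the unique extension property.  (The twisted tensor product is
encoded through realizations `(C, ψ)` of `(A ⊗ B, μ_τ)`, with the transported Künneth
grading.) -/
theorem stmt8 (𝕜 : Type) [Field 𝕜] (A B : Type) [Ring A] [Algebra 𝕜 A] [Ring B] [Algebra 𝕜 B]
    (𝒜 : ℕ → Submodule 𝕜 A) (ℬ : ℕ → Submodule 𝕜 B)
    [GradedAlgebra 𝒜] [GradedAlgebra ℬ]
    (hconnA : 𝒜 0 = (1 : Submodule 𝕜 A)) (hconnB : ℬ 0 = (1 : Submodule 𝕜 B))
    (hquadA : IsQuadraticAlg 𝕜 A 𝒜) (hquadB : IsQuadraticAlg 𝕜 B ℬ)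
    (τ : B ⊗[𝕜] A →ₗ[𝕜] A ⊗[𝕜] B)
    (hτ : IsGradedTwisting 𝕜 A B 𝒜 ℬ τ)
    (hquadC : ∀ (C : Type) [Ring C] [Algebra 𝕜 C], ∀ ψ : A ⊗[𝕜] B →ₗ[𝕜] C,
      Realizes 𝕜 A B τ C ψ →
      IsQuadraticAlg 𝕜 C (fun n => Submodule.map ψ (kunneth 𝕜 𝒜 ℬ n))) :
    UEP 𝕜 A B 𝒜 ℬ τ := by
  rcases subsingleton_or_nontrivial A with hA | hA
  · intro n _ τ' _ _ x _
    have : Subsingleton (A ⊗[𝕜] B) := inferInstance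
    exact Subsingleton.elim _ _
  rcases subsingleton_or_nontrivial B with hB | hB
  · intro n _ τ' _ _ x _
    have : Subsingleton (A ⊗[𝕜] B) := inferInstance
    exact Subsingleton.elim _ _
  obtain ⟨εA, hεA, hεA0⟩ := exists_counit 𝒜 hconnA
  obtain ⟨εB, hεB, hεB0⟩ := exists_counit ℬ hconnB
  intro n hn τ' hτ' hlt x hx
  have hτn := hτ.twistingToDeg n
  obtain ⟨δ, hδ⟩ : ∃ δ, IsConcentrated 𝒜 ℬ n (τ' - τ) δ := exists_concentrated ℬ 𝒜 (τ' - τ) n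
  have hδ0 : δ = 0 := by
    refine eq_zero_of_cocycle hquadA.1 hquadB.1 hconnA hconnB hεA hεB hτ
      (hquadC _ _ (TwistedTensor.realizes hτ.1)) (hδ.one_tmul hτn hτ') (hδ.tmul_one hτn hτ') ?_
      (hδ.mul_tmul hτn hτ' hlt hεB hεB0) (hδ.tmul_mul hτn hτ' hlt hεA hεA0)
    intro b hb a ha
    rw [hδ 1 1 b hb a ha, if_neg (by omega)]
  refine eq_of_mem_kunneth (fun i j hij b hb a ha => ?_) hx
  have h := hδ i j b hb a ha
  rw [if_pos hij, hδ0, LinearMap.zero_apply, LinearMap.sub_apply] at h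
  exact sub_eq_zero.1 h.symm

end TTP
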